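/- Let E|k be a finite extension of non-Archimedean local fields, let p be the characteristic and q the cardinality of the residue field κ_k, and let f := f(E|k). Let e′ be a positive integer dividing e(E|k) which is coprime to p·(1 + q + q² + … + q^{f−1}). Then there exist a uniformizer π_k of k and an element α ∈ E such that α^{e′} = π_k. -/

import Mathlib

noncomputable section

/-- Axioms expressing that `ν : K → EReal` is the additive valuation of a
non-Archimedean local (skew) field structure on `K`, normalized relatively to a base
field with valuation group `ℤ`, so that the value group of `K` is `(1/e)ℤ`; `K` is
complete and its residue field has exactly `q` elements (encoded by a complete finite
set of residue representatives). -/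
structure IsLocalValuation (K : Type*) [DivisionRing K] (ν : K → EReal) (e q : ℕ) : Prop where
  e_pos : 0 < e
  one_lt_q : 1 < q
  eq_top_iff : ∀ x : K, ν x = ⊤ ↔ x = 0
  map_mul : ∀ x y : K, ν (x * y) = ν x + ν y
  min_le_add : ∀ x y : K, min (ν x) (ν y) ≤ ν (x + y)
  values : ∀ x : K, x ≠ 0 → ∃ m : ℤ, ν x = ((m / e : ℝ) : EReal)
  exists_uniformizer : ∃ π : K, ν π = (((e : ℝ)⁻¹ : ℝ) : EReal)
  complete : ∀ x : ℕ → K,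
      (∀ M : ℝ, ∃ N : ℕ, ∀ m ≥ N, ∀ n ≥ N, (M : EReal) ≤ ν (x m - x n)) →
      ∃ l : K, ∀ M : ℝ, ∃ N : ℕ, ∀ n ≥ N, (M : EReal) ≤ ν (x n - l)
  residue : ∃ s : Finset K, s.card = q ∧ (∀ y ∈ s, 0 ≤ ν y) ∧
      ∀ x : K, 0 ≤ ν x → ∃! y, y ∈ s ∧ 0 < ν (x - y)

namespace IsLocalValuation

variable {K : Type*} [Field K] {ν : K → EReal} {e q : ℕ}

theorem map_zero (h : IsLocalValuation K ν e q) : ν 0 = ⊤ := (h.eq_top_iff 0).2 rfl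

theorem exists_real (h : IsLocalValuation K ν e q) {x : K} (hx : x ≠ 0) :
    ∃ r : ℝ, ν x = r :=
  let ⟨_, hm⟩ := h.values x hx
  ⟨_, hm⟩

theorem map_one (h : IsLocalValuation K ν e q) : ν 1 = 0 := by
  obtain ⟨r, hr⟩ := h.exists_real one_ne_zero
  have h1 := h.map_mul 1 1
  rw [mul_one, hr] at h1
  norm_cast at h1
  rw [hr]
  norm_cast
  linarith

theorem map_neg (h : IsLocalValuation K ν e q) (x : K) : ν (-x) = ν x := by
  obtain ⟨r, hr⟩ := h.exists_real (neg_ne_zero.2 (one_ne_zero (α := K)))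
  have h1 := h.map_mul (-1) (-1)
  rw [neg_mul_neg, mul_one, h.map_one, hr] at h1
  norm_cast at h1
  have h2 : r = 0 := by linarith
  rw [← neg_one_mul, h.map_mul, hr, h2]
  simp

theorem le_sub (h : IsLocalValuation K ν e q) {M : EReal} {x y : K}
    (hx : M ≤ ν x) (hy : M ≤ ν y) : M ≤ ν (x - y) := by
  rw [sub_eq_add_neg]
  exact (le_min hx ((h.map_neg y).symm ▸ hy)).trans (h.min_le_add _ _)

theorem map_sub_comm (h : IsLocalValuation K ν e q) (x y : K) : ν (x - y) = ν (y - x) := by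
  rw [← h.map_neg, neg_sub]

theorem map_inv (h : IsLocalValuation K ν e q) {x : K} (hx : x ≠ 0) : ν x⁻¹ = - ν x := by
  obtain ⟨r, hr⟩ := h.exists_real hx
  obtain ⟨t, ht⟩ := h.exists_real (inv_ne_zero hx)
  have h1 := h.map_mul x x⁻¹
  rw [mul_inv_cancel₀ hx, h.map_one, hr, ht] at h1
  norm_cast at h1
  rw [hr, ht]
  norm_cast
  linarith

theorem map_pow (h : IsLocalValuation K ν e q) {x : K} {r : ℝ} (hx : ν x = r) (n : ℕ) :
    ν (x ^ n) = ((n * r : ℝ) : EReal) := by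
  induction n with
  | zero => simp [h.map_one]
  | succ n ih =>
    rw [pow_succ, h.map_mul, ih, hx]
    norm_cast
    push_cast
    ring

/-- The valuation ring. -/
def integer (h : IsLocalValuation K ν e q) : ValuationSubring K where
  carrier := {x | 0 ≤ ν x}
  mul_mem' {a b} ha hb := by
    simp only [Set.mem_ofPred_eq, h.map_mul] at *
    exact add_nonneg ha hb
  one_mem' := h.map_one.ge
  add_mem' {a b} ha hb := (le_min ha hb).trans (h.min_le_add _ _)
  zero_mem' := by simp [h.map_zero]
  neg_mem' {x} hx := by simpa [h.map_neg] using hx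
  mem_or_inv_mem' x := by
    by_cases hx : x = 0
    · simp [hx, h.map_zero]
    · simp only [Set.mem_ofPred_eq, h.map_inv hx]
      obtain ⟨r, hr⟩ := h.exists_real hx
      rw [hr]
      norm_cast
      rcases le_total 0 r with h0 | h0
      · exact Or.inl h0
      · exact Or.inr (by linarith)

theorem mem_integer (h : IsLocalValuation K ν e q) {x : K} : x ∈ h.integer ↔ 0 ≤ ν x := Iff.rfl

theorem mem_maximalIdeal (h : IsLocalValuation K ν e q) (x : h.integer) :
    x ∈ IsLocalRing.maximalIdeal h.integer ↔ 0 < ν (x : K) := by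
  rw [IsLocalRing.mem_maximalIdeal, mem_nonunits_iff, not_iff_comm, not_lt]
  have hx0 : 0 ≤ ν (x : K) := x.2
  constructor
  · intro hx
    have hx' : (x : K) ≠ 0 := by
      intro h0
      rw [h0, h.map_zero] at hx
      simp at hx
    have hinv : (x : K)⁻¹ ∈ h.integer := by
      rw [h.mem_integer, h.map_inv hx', le_antisymm hx hx0]
      simp
    exact IsUnit.of_mul_eq_one ⟨_, hinv⟩ (Subtype.ext (mul_inv_cancel₀ hx'))
  · intro hx
    obtain ⟨y, hy⟩ := hx.exists_right_inv
    have h1 : (x : K) * y = 1 := congrArg Subtype.val hy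
    have h2 := h.map_mul x y
    rw [h1, h.map_one] at h2
    have hy0 : 0 ≤ ν (y : K) := y.2
    calc ν (x : K) ≤ ν (x : K) + ν (y : K) := le_add_of_nonneg_right hy0
      _ = 0 := h2.symm

theorem residue_eq_iff (h : IsLocalValuation K ν e q) (x y : h.integer) :
    IsLocalRing.residue h.integer x = IsLocalRing.residue h.integer y ↔ 0 < ν (x - y : K) := by
  rw [← sub_eq_zero, ← _root_.map_sub, IsLocalRing.residue_eq_zero_iff, h.mem_maximalIdeal]
  rfl

theorem card_residueField (h : IsLocalValuation K ν e q) :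
    Nat.card (IsLocalRing.ResidueField h.integer) = q := by
  obtain ⟨s, hs, hs0, hs1⟩ := h.residue
  let g : s → IsLocalRing.ResidueField h.integer :=
    fun y ↦ IsLocalRing.residue h.integer ⟨y, hs0 y y.2⟩
  have hg : Function.Bijective g := by
    constructor
    · intro a b hab
      have := (h.residue_eq_iff _ _).1 hab
      obtain ⟨y, -, hy⟩ := hs1 a (hs0 a a.2)
      have ha := hy a ⟨a.2, by simp [h.map_zero]⟩
      have hb := hy b ⟨b.2, this⟩
      exact Subtype.ext (ha.trans hb.symm)
    · intro z
      obtain ⟨x, rfl⟩ := IsLocalRing.residue_surjective z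
      obtain ⟨y, ⟨hy, hxy⟩, -⟩ := hs1 x x.2
      refine ⟨⟨y, hy⟩, (h.residue_eq_iff _ _).2 ?_⟩
      rw [h.map_sub_comm]
      exact hxy
  rw [← Nat.card_eq_of_bijective g hg]
  simpa using hs

theorem finite_residueField (h : IsLocalValuation K ν e q) :
    Finite (IsLocalRing.ResidueField h.integer) :=
  Nat.finite_of_card_ne_zero <| by
    rw [h.card_residueField]
    exact (zero_lt_one.trans h.one_lt_q).ne'

theorem mem_maximalIdeal_pow (h : IsLocalValuation K ν e q) (n : ℕ) (x : h.integer) :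
    x ∈ IsLocalRing.maximalIdeal h.integer ^ n ↔ ((n / e : ℝ) : EReal) ≤ ν (x : K) := by
  have he : (0 : ℝ) < e := by exact_mod_cast h.e_pos
  obtain ⟨π, hπ⟩ := h.exists_uniformizer
  have hπ0 : π ≠ 0 := by
    rintro rfl
    rw [h.map_zero] at hπ
    exact EReal.coe_ne_top _ hπ.symm
  have key : ∀ (n : ℕ) (hn : 0 ≤ ν (π ^ n)) (x : h.integer),
      x ∈ Ideal.span {(⟨π ^ n, hn⟩ : h.integer)} ↔ ((n / e : ℝ) : EReal) ≤ ν (x : K) := by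
    intro n hn x
    have hπn := h.map_pow hπ n
    rw [← div_eq_mul_inv] at hπn
    rw [Ideal.mem_span_singleton]
    constructor
    · rintro ⟨y, rfl⟩
      have hy0 : 0 ≤ ν (y : K) := y.2
      change _ ≤ ν (π ^ n * y)
      rw [h.map_mul, hπn]
      exact le_add_of_nonneg_right hy0
    · intro hx
      have hmem : 0 ≤ ν ((π ^ n)⁻¹ * x) := by
        by_cases hx0 : (x : K) = 0
        · simp [hx0, h.map_zero]
        obtain ⟨r, hr⟩ := h.exists_real hx0
        rw [h.map_mul, h.map_inv (pow_ne_zero n hπ0), hπn, hr]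
        rw [hr] at hx
        norm_cast at hx ⊢
        linarith
      exact ⟨⟨_, hmem⟩, Subtype.ext (mul_inv_cancel_left₀ (pow_ne_zero n hπ0) _).symm⟩
  have hπm : 0 ≤ ν (π ^ 1) := by
    rw [pow_one, hπ]
    norm_cast
    positivity
  have hmax : IsLocalRing.maximalIdeal h.integer = Ideal.span {(⟨π ^ 1, hπm⟩ : h.integer)} := by
    ext x
    rw [key, h.mem_maximalIdeal]
    by_cases hx0 : (x : K) = 0
    · simp [hx0, h.map_zero]
    obtain ⟨m, hm⟩ := h.values x hx0
    rw [hm]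
    rw [EReal.coe_le_coe_iff, ← EReal.coe_zero, EReal.coe_lt_coe_iff,
      div_pos_iff_of_pos_right he, div_le_div_iff_of_pos_right he]
    norm_cast
  have hn : 0 ≤ ν (π ^ n) := by
    rw [h.map_pow hπ]
    norm_cast
    positivity
  rw [hmax, Ideal.span_singleton_pow, ← key n hn]
  have : (⟨π ^ 1, hπm⟩ : h.integer) ^ n = ⟨π ^ n, hn⟩ := Subtype.ext (by simp)
  rw [this]

theorem sModEq_iff (h : IsLocalValuation K ν e q) (n : ℕ) (x y : h.integer) :
    x ≡ y [SMOD (IsLocalRing.maximalIdeal h.integer ^ n • ⊤ : Submodule h.integer h.integer)] ↔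
      ((n / e : ℝ) : EReal) ≤ ν (x - y : K) := by
  rw [SModEq.sub_mem, smul_eq_mul, Ideal.mul_top, h.mem_maximalIdeal_pow]
  rfl

theorem exists_nat_le_div (h : IsLocalValuation K ν e q) (M : ℝ) : ∃ N : ℕ, M ≤ N / e := by
  have he : (0 : ℝ) < e := by exact_mod_cast h.e_pos
  obtain ⟨N, hN⟩ := exists_nat_ge (M * e)
  exact ⟨N, (le_div_iff₀ he).2 hN⟩

theorem isAdicComplete (h : IsLocalValuation K ν e q) :
    IsAdicComplete (IsLocalRing.maximalIdeal h.integer) h.integer where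
  haus' x hx := by
    by_contra hx0
    have hx0' : (x : K) ≠ 0 := fun h0 ↦ hx0 (Subtype.ext h0)
    obtain ⟨r, hr⟩ := h.exists_real hx0'
    obtain ⟨N, hN⟩ := h.exists_nat_le_div (r + 1)
    have h1 := (h.sModEq_iff N x 0).1 (hx N)
    rw [ZeroMemClass.coe_zero, sub_zero, hr] at h1
    norm_cast at h1
    linarith
  prec' f hf := by
    have he : (0 : ℝ) < e := by exact_mod_cast h.e_pos
    have hf' : ∀ {m n : ℕ}, m ≤ n → ((m / e : ℝ) : EReal) ≤ ν (f m - f n : K) :=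
      fun hmn ↦ (h.sModEq_iff _ _ _).1 (hf hmn)
    have hmono : ∀ {m n : ℕ}, m ≤ n → ((m / e : ℝ) : EReal) ≤ ((n / e : ℝ) : EReal) := by
      intro m n hmn
      norm_cast
      gcongr
    obtain ⟨l, hl⟩ := h.complete (fun n ↦ (f n : K)) (by
      intro M
      obtain ⟨N, hN⟩ := h.exists_nat_le_div M
      refine ⟨N, fun m hm n hn ↦ (EReal.coe_le_coe_iff.2 hN).trans ?_⟩
      have h1 := h.le_sub (hf' hn) (hf' hm)
      simpa using h1)
    have hl' : ∀ n : ℕ, ((n / e : ℝ) : EReal) ≤ ν (f n - l : K) := by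
      intro n
      obtain ⟨N, hN⟩ := hl (n / e)
      have h1 := hN (max n N) (le_max_right _ _)
      rw [h.map_sub_comm] at h1
      simpa using h.le_sub (hf' (le_max_left n N)) h1
    have hmem : 0 ≤ ν l := by
      have h0 := hl' 0
      simp only [Nat.cast_zero, zero_div, EReal.coe_zero] at h0
      simpa using h.le_sub (f 0).2 h0
    exact ⟨⟨l, hmem⟩, fun n ↦ (h.sModEq_iff _ _ _).2 (hl' n)⟩

/-- Hensel's lemma for `d`-th roots with `d` prime to the residue characteristic. -/
theorem exists_pow_eq (h : IsLocalValuation K ν e q) {d : ℕ} (hd : d.Coprime q) (a : h.integer)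
    (ha : IsLocalRing.residue h.integer a ≠ 0)
    (hb : ∃ b, b ^ d = IsLocalRing.residue h.integer a) : ∃ β : h.integer, β ^ d = a := by
  obtain ⟨b, hb⟩ := hb
  obtain ⟨b, rfl⟩ := IsLocalRing.residue_surjective b
  have hq : (q : IsLocalRing.ResidueField h.integer) = 0 := by
    have := h.finite_residueField
    have := Fintype.ofFinite (IsLocalRing.ResidueField h.integer)
    have hcard := Nat.cast_card_eq_zero (IsLocalRing.ResidueField h.integer)
    rwa [← Nat.card_eq_fintype_card, h.card_residueField] at hcard
  have hd0 : (d : IsLocalRing.ResidueField h.integer) ≠ 0 := by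
    intro h0
    obtain ⟨u, v, huv⟩ := (Nat.isCoprime_iff_coprime.2 hd)
    have := congrArg (Int.cast : ℤ → IsLocalRing.ResidueField h.integer) huv
    simp [h0, hq] at this
  have hdpos : d ≠ 0 := by
    rintro rfl
    simp at hd0
  have hb0 : IsLocalRing.residue h.integer b ≠ 0 := by
    intro h0
    rw [h0, zero_pow hdpos] at hb
    exact ha hb.symm
  have := h.isAdicComplete
  obtain ⟨β, hβ, -⟩ := HenselianRing.is_henselian (I := IsLocalRing.maximalIdeal h.integer)
    (Polynomial.X ^ d - Polynomial.C a) (Polynomial.monic_X_pow_sub_C a hdpos) b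
    (by
      rw [← IsLocalRing.residue_eq_zero_iff]
      simp [hb])
    (by
      change IsUnit (IsLocalRing.residue h.integer _)
      rw [isUnit_iff_ne_zero, Polynomial.derivative_sub, Polynomial.derivative_X_pow,
        Polynomial.derivative_C, sub_zero, Polynomial.eval_mul, Polynomial.eval_pow,
        Polynomial.eval_X, Polynomial.eval_C, _root_.map_mul, _root_.map_pow, map_natCast]
      exact mul_ne_zero hd0 (pow_ne_zero _ hb0))
  refine ⟨β, sub_eq_zero.1 ?_⟩
  simpa [Polynomial.IsRoot] using hβ

end IsLocalValuation

/-- In a field with `q ^ f` elements, an element is the product of a `d`-th power and an element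
fixed by the `q`-th power map, provided `d` is prime to `1 + q + ⋯ + q ^ (f - 1)`. -/
theorem exists_pow_mul_eq_of_coprime_geom_sum {F : Type*} [Field F] {q f d : ℕ} (hq : 0 < q)
    (hF : Nat.card F = q ^ f) (hd : d.Coprime (∑ i ∈ Finset.range f, q ^ i)) {a : F}
    (ha : a ≠ 0) : ∃ b c : F, b ^ d * c = a ∧ c ^ q = c := by
  have : Finite F := Nat.finite_of_card_ne_zero (by rw [hF]; positivity)
  have := Fintype.ofFinite F
  set N := ∑ i ∈ Finset.range f, q ^ i with hN
  obtain ⟨u, v, huv⟩ := Nat.isCoprime_iff_coprime.2 hd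
  have hz : a ^ (N * (q - 1)) = 1 := by
    rw [hN, geom_sum_mul_of_one_le (R := ℕ) hq, ← hF, Nat.card_eq_fintype_card]
    exact FiniteField.pow_card_sub_one_eq_one a ha
  have hzq : (a ^ N) ^ q = a ^ N := by
    obtain ⟨r, rfl⟩ := Nat.exists_eq_add_of_le' hq
    rw [pow_succ, ← pow_mul]
    simp at hz
    rw [hz, one_mul]
  refine ⟨a ^ u, (a ^ N) ^ v, ?_, ?_⟩
  · rw [← zpow_natCast, ← zpow_natCast, ← zpow_mul, ← zpow_mul, ← zpow_add₀ ha,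
      mul_comm (N : ℤ), huv, zpow_one]
  · rw [← zpow_natCast, ← zpow_mul, mul_comm, zpow_mul, zpow_natCast, hzq]

/-- The elements of a field fixed by the `q`-th power map form the subfield with `q` elements. -/
theorem RingHom.mem_range_of_pow_card_eq {F L : Type*} [Field F] [_root_.Finite F] [Field L]
    (φ : F →+* L) {y : L} (hy : y ^ Nat.card F = y) : y ∈ Set.range φ := by
  classical
  have := Fintype.ofFinite F
  rw [Nat.card_eq_fintype_card] at hy
  have h1 : 1 < Fintype.card F := Fintype.one_lt_card
  have hP : (Polynomial.X ^ Fintype.card F - Polynomial.X : Polynomial L) ≠ 0 :=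
    FiniteField.X_pow_card_sub_X_ne_zero L h1
  have hsub : Finset.univ.image φ ⊆
      (Polynomial.X ^ Fintype.card F - Polynomial.X : Polynomial L).roots.toFinset := by
    intro z hz
    obtain ⟨x, -, rfl⟩ := Finset.mem_image.1 hz
    simp [hP, ← map_pow, FiniteField.pow_card]
  have heq := Finset.eq_of_subset_of_card_le hsub (by
    rw [Finset.card_image_of_injective _ φ.injective, Finset.card_univ]
    refine (Multiset.toFinset_card_le _).trans ((Polynomial.card_roots' _).trans ?_)
    rw [FiniteField.X_pow_card_sub_X_natDegree_eq L h1])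
  have hmem : y ∈ (Polynomial.X ^ Fintype.card F - Polynomial.X : Polynomial L).roots.toFinset := by
    simp [hP, hy]
  rw [← heq] at hmem
  simpa using hmem

/-- A residue class of `E` fixed by the `q`-th power map is represented by an element of `k`. -/
theorem IsLocalValuation.exists_residue_algebraMap_eq {k E : Type*} [Field k] [Field E]
    [Algebra k E] {νk : k → EReal} {νE : E → EReal} {e₀ e q qE : ℕ}
    (hk : IsLocalValuation k νk e₀ q) (hE : IsLocalValuation E νE e qE)
    (hcompat : ∀ c : k, νE (algebraMap k E c) = νk c)
    {y : IsLocalRing.ResidueField hE.integer} (hy : y ^ q = y) :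
    ∃ (c : k) (hc : algebraMap k E c ∈ hE.integer),
      IsLocalRing.residue hE.integer ⟨algebraMap k E c, hc⟩ = y := by
  have hmem : ∀ c : hk.integer, algebraMap k E c ∈ hE.integer := fun c ↦ by
    rw [hE.mem_integer, hcompat]
    exact c.2
  let φ : hk.integer →+* hE.integer :=
    ((algebraMap k E).comp hk.integer.subtype).codRestrict hE.integer hmem
  let ψ : IsLocalRing.ResidueField hk.integer →+* IsLocalRing.ResidueField hE.integer :=
    Ideal.Quotient.lift _ ((IsLocalRing.residue hE.integer).comp φ) fun c hc ↦ by
      rw [RingHom.comp_apply, IsLocalRing.residue_eq_zero_iff, hE.mem_maximalIdeal]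
      change 0 < νE (algebraMap k E c)
      rw [hcompat]
      exact (hk.mem_maximalIdeal c).1 hc
  have := hk.finite_residueField
  obtain ⟨x, hx⟩ := ψ.mem_range_of_pow_card_eq (hk.card_residueField.symm ▸ hy)
  obtain ⟨c, rfl⟩ := IsLocalRing.residue_surjective x
  exact ⟨c, hmem c, hx⟩

/-- Let `E|k` be a finite extension of non-Archimedean local fields,
`p` the residue characteristic and `q = #κ_k`, `f = f(E|k)`.  If `e′` is a positive
divisor of `e(E|k)` coprime to `p·(1 + q + ⋯ + q^{f-1})`, then some uniformizer of `k`
has an `e′`-th root in `E`. -/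
theorem stmt_7
    {k E : Type*} [Field k] [Field E] [Algebra k E] [FiniteDimensional k E]
    (νk : k → EReal) (νE : E → EReal) (e f q qE : ℕ)
    (hk : IsLocalValuation k νk 1 q) (hE : IsLocalValuation E νE e qE)
    (hcompat : ∀ c : k, νE (algebraMap k E c) = νk c)
    (hdeg : Module.finrank k E = e * f) (hresdeg : qE = q ^ f)
    (p : ℕ) (hp : p.Prime) (hqp : ∃ n : ℕ, q = p ^ n)
    (e' : ℕ) (he' : 0 < e') (hdvd : e' ∣ e)
    (hcop : Nat.Coprime e' (p * ∑ i ∈ Finset.range f, q ^ i)) :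
    ∃ (πk : k) (α : E), νk πk = (1 : EReal) ∧ α ^ e' = algebraMap k E πk := by
  have he : (e : ℝ) ≠ 0 := by exact_mod_cast hE.e_pos.ne'
  obtain ⟨π, hπ⟩ := hk.exists_uniformizer
  obtain ⟨ϖ, hϖ⟩ := hE.exists_uniformizer
  have hπ' : νk π = 1 := by simpa using hπ
  have hπ0 : algebraMap k E π ≠ 0 := by
    rw [Ne, ← hE.eq_top_iff, hcompat, hπ]
    exact EReal.coe_ne_top _
  have hϖe : νE (ϖ ^ e) = 1 := by
    rw [hE.map_pow hϖ, mul_inv_cancel₀ he]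
    rfl
  have ha : νE (ϖ ^ e * (algebraMap k E π)⁻¹) = 0 := by
    rw [hE.map_mul, hE.map_inv hπ0, hcompat, hπ', hϖe]
    exact EReal.sub_self (EReal.coe_ne_top 1) (EReal.coe_ne_bot 1)
  obtain ⟨a, haE⟩ : ∃ a : hE.integer, (a : E) = ϖ ^ e * (algebraMap k E π)⁻¹ := ⟨⟨_, ha.ge⟩, rfl⟩
  have hares : IsLocalRing.residue hE.integer a ≠ 0 := by
    rw [Ne, IsLocalRing.residue_eq_zero_iff, hE.mem_maximalIdeal, haE, ha]
    exact lt_irrefl _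
  obtain ⟨b, c', hbc, hc'⟩ := exists_pow_mul_eq_of_coprime_geom_sum (zero_lt_one.trans hk.one_lt_q)
    (hE.card_residueField.trans hresdeg) hcop.coprime_mul_left_right hares
  obtain ⟨c, hc, rfl⟩ := hk.exists_residue_algebraMap_eq hE hcompat hc'
  have hcres : IsLocalRing.residue hE.integer ⟨algebraMap k E c, hc⟩ ≠ 0 := by
    intro h0
    rw [h0, mul_zero] at hbc
    exact hares hbc.symm
  have hcunit : IsUnit (⟨algebraMap k E c, hc⟩ : hE.integer) := by
    by_contra hcu
    exact hcres ((IsLocalRing.residue_eq_zero_iff _).2 hcu)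
  obtain ⟨d, hd⟩ := hcunit.dvd (a := a)
  have hdE : (a : E) = algebraMap k E c * d := congrArg Subtype.val hd
  have hdres : b ^ e' = IsLocalRing.residue hE.integer d := by
    rw [hd, map_mul, mul_comm] at hbc
    exact mul_left_cancel₀ hcres hbc
  have hcν : νk c = 0 := by
    rw [Ne, IsLocalRing.residue_eq_zero_iff, hE.mem_maximalIdeal, not_lt] at hcres
    rw [← hcompat]
    exact le_antisymm hcres hc
  have hd0 : IsLocalRing.residue hE.integer d ≠ 0 := by
    intro h0
    rw [hd, map_mul, h0, mul_zero] at hares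
    exact hares rfl
  have hcopE : e'.Coprime qE := by
    obtain ⟨n, rfl⟩ := hqp
    rw [hresdeg, ← pow_mul]
    exact hcop.coprime_mul_right_right.pow_right _
  obtain ⟨β, hβ⟩ := hE.exists_pow_eq hcopE d hd0 ⟨b, hdres⟩
  have hβE : (β : E) ^ e' = d := congrArg Subtype.val hβ
  have hdE0 : (d : E) ≠ 0 := by
    intro h0
    exact hd0 (by rw [show d = 0 from Subtype.ext h0, map_zero])
  refine ⟨c * π, ϖ ^ (e / e') / β, by rw [hk.map_mul, hcν, hπ', zero_add], ?_⟩
  rw [div_pow, ← pow_mul, Nat.div_mul_cancel hdvd, hβE, map_mul, div_eq_iff hdE0]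
  have h1 : ϖ ^ e = a * algebraMap k E π := by
    rw [haE, inv_mul_cancel_right₀ hπ0]
  rw [h1, hdE]
  ring
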